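/- Bernstein-type inequality for the Gegenbauer differential operator: let λ > 0 and let r be a positive integer. For each 1 ≤ p ≤ ∞ there is a constant c, depending only on λ, p and r, such that for every n ≥ 1 and every polynomial g of degree at most n in one real variable, ‖(−Λ_λ)^{r/2} g‖_{w_λ,p} ≤ c n^r ‖g‖_{w_λ,p}. -/

import Mathlib

open MeasureTheory Real ENNReal NNReal

noncomputable section

namespace GegenbauerBernstein

/-- The (unnormalized) measure `w_λ(t) dt = (1-t²)^{λ-1/2} dt` on `(-1,1)`. -/
def wM (lam : ℝ) : Measure ℝ :=
  ((volume : Measure ℝ).restrict (Set.Ioo (-1 : ℝ) 1)).withDensity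
    fun t => ENNReal.ofReal ((1 - t ^ 2) ^ (lam - 1/2))

/-- The normalized measure `c_λ w_λ(t) dt` on `(-1,1)`. -/
def νm (lam : ℝ) : Measure ℝ := (wM lam Set.univ)⁻¹ • wM lam

/-- The Gegenbauer polynomials `C_n^λ`, via the three-term recurrence
`(n+2) C_{n+2}^λ(t) = 2(n+1+λ) t C_{n+1}^λ(t) - (n+2λ) C_n^λ(t)`; they are the orthogonal
polynomials for `w_λ` and eigenfunctions of
`Λ_λ f = w_λ⁻¹ [(1-t²) w_λ f']'` with `Λ_λ C_n^λ = -n(n+2λ) C_n^λ`. -/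
def gegen (lam : ℝ) : ℕ → ℝ → ℝ
  | 0 => fun _ => 1
  | 1 => fun t => 2 * lam * t
  | n + 2 => fun t =>
      (2 * ((n : ℝ) + 1 + lam) * t * gegen lam (n+1) t - ((n : ℝ) + 2 * lam) * gegen lam n t)
        / ((n : ℝ) + 2)

section

open Polynomial

/-- The operator `Λ_λ P = (1 - t²) P'' - (2λ + 1) t P'` on polynomials. -/
def gegenOp (lam : ℝ) : ℝ[X] →ₗ[ℝ] ℝ[X] :=
  LinearMap.mulLeft ℝ (1 - X ^ 2) ∘ₗ derivative ∘ₗ derivative -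
    LinearMap.mulLeft ℝ (C (2 * lam + 1) * X) ∘ₗ derivative

lemma gegenOp_apply (lam : ℝ) (P : ℝ[X]) :
    gegenOp lam P = (1 - X ^ 2) * derivative (derivative P) -
      C (2 * lam + 1) * X * derivative P := by
  simp [gegenOp, mul_assoc]

/-- The Gegenbauer polynomials as elements of `ℝ[X]`. -/
def gegenPoly (lam : ℝ) : ℕ → ℝ[X]
  | 0 => 1
  | 1 => C (2 * lam) * X
  | n + 2 => C (((n : ℝ) + 2)⁻¹) *
      (C (2 * ((n : ℝ) + 1 + lam)) * X * gegenPoly lam (n + 1) -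
        C ((n : ℝ) + 2 * lam) * gegenPoly lam n)

lemma eval_gegenPoly (lam : ℝ) (n : ℕ) (t : ℝ) : (gegenPoly lam n).eval t = gegen lam n t := by
  induction n using Nat.twoStepInduction with
  | zero => simp [gegenPoly, gegen]
  | one => simp [gegenPoly, gegen]
  | more n h₀ h₁ =>
    simp only [gegenPoly, gegen, eval_mul, eval_sub, eval_C, eval_X, h₀, h₁]
    rw [div_eq_inv_mul]

lemma gegenPoly_add_two (lam : ℝ) (n : ℕ) :
    C ((n : ℝ) + 2) * gegenPoly lam (n + 2) =
      C (2 * ((n : ℝ) + 1 + lam)) * X * gegenPoly lam (n + 1) -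
        C ((n : ℝ) + 2 * lam) * gegenPoly lam n := by
  have h : C ((n : ℝ) + 2) * C (((n : ℝ) + 2)⁻¹) = 1 := by
    rw [← C_mul, mul_inv_cancel₀ (by positivity), C_1]
  rw [gegenPoly, ← mul_assoc, h, one_mul]

lemma one_sub_X_sq_mul_derivative_gegenPoly (lam : ℝ) (n : ℕ) :
    (1 - X ^ 2) * derivative (gegenPoly lam (n + 1)) =
        -(C ((n : ℝ) + 1) * X * gegenPoly lam (n + 1)) + C ((n : ℝ) + 2 * lam) * gegenPoly lam n ∧
      (1 - X ^ 2) * derivative (gegenPoly lam n) =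
        C ((n : ℝ) + 2 * lam) * X * gegenPoly lam n -
          C ((n : ℝ) + 1) * gegenPoly lam (n + 1) := by
  induction n with
  | zero => constructor <;> (simp [gegenPoly]; try ring)
  | succ n ih =>
    obtain ⟨ih₁, ih₂⟩ := ih
    have hrec := gegenPoly_add_two lam n
    have hd := congrArg derivative hrec
    have hne : C ((n : ℝ) + 2) ≠ 0 := by
      rw [Ne, C_eq_zero]; positivity
    simp only [derivative_sub, derivative_mul, derivative_C, derivative_X] at hd
    simp only [map_add, map_mul, map_natCast, map_ofNat, map_one] at hrec hd ih₁ ih₂ hne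
    push_cast
    simp only [map_add, map_mul, map_natCast, map_ofNat, map_one]
    constructor
    · apply mul_left_cancel₀ hne
      linear_combination (1 - X ^ 2) * hd + 2 * ((n : ℝ[X]) + 1 + C lam) * X * ih₁ -
        ((n : ℝ[X]) + 2 * C lam) * ih₂ + ((n : ℝ[X]) + 2) * X * hrec
    · linear_combination ih₁ + hrec

lemma gegenOp_gegenPoly (lam : ℝ) (n : ℕ) :
    gegenOp lam (gegenPoly lam n) = C (-((n : ℝ) * (n + 2 * lam))) * gegenPoly lam n := by
  obtain ⟨h₁, h₂⟩ := one_sub_X_sq_mul_derivative_gegenPoly lam n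
  have hd := congrArg derivative h₂
  have hne : (1 - X ^ 2 : ℝ[X]) ≠ 0 := by
    intro h
    simpa using congrArg (eval 0) h
  rw [gegenOp_apply]
  simp only [derivative_sub, derivative_mul, derivative_C, derivative_X, derivative_one,
    derivative_X_pow] at hd
  simp only [map_add, map_mul, map_neg, map_natCast, map_ofNat, map_one] at hd h₁ h₂ ⊢
  apply mul_left_cancel₀ hne
  push_cast at hd
  linear_combination (1 - X ^ 2) * hd - (n + 1) * h₁ + ((n : ℝ[X]) + 1) * X * h₂

lemma coeff_gegenOp (lam : ℝ) (P : ℝ[X]) (m : ℕ) :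
    (gegenOp lam P).coeff m =
      ((m : ℝ) + 1) * (m + 2) * P.coeff (m + 2) - (m : ℝ) * (m + 2 * lam) * P.coeff m := by
  rw [gegenOp_apply, sub_mul, one_mul, mul_assoc (C _)]
  simp only [coeff_sub, coeff_C_mul, coeff_derivative]
  rcases m with - | - | m
  · simp
    ring
  · simp [coeff_X_pow_mul', coeff_X_mul, coeff_derivative]
    ring
  · rw [coeff_X_pow_mul, coeff_X_mul]
    simp only [coeff_derivative]
    push_cast
    ring

lemma eq_zero_of_gegenOp_eq {lam : ℝ} (hlam : 0 < lam) {k : ℕ} {P : ℝ[X]}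
    (hP : gegenOp lam P = C (-((k : ℝ) * (k + 2 * lam))) * P) (hk : P.coeff k = 0) : P = 0 := by
  by_contra h0
  have h := coeff_gegenOp lam P P.natDegree
  have hlc : P.coeff P.natDegree ≠ 0 := by simpa using h0
  rw [hP, coeff_C_mul, coeff_eq_zero_of_natDegree_lt (n := P.natDegree + 2) (by omega), mul_zero,
    zero_sub] at h
  have h2 : (k : ℝ) * (k + 2 * lam) = P.natDegree * (P.natDegree + 2 * lam) :=
    mul_right_cancel₀ hlc (by linear_combination -h)
  have h3 : ((k : ℝ) - P.natDegree) * (k + P.natDegree + 2 * lam) = 0 := by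
    linear_combination h2
  rcases mul_eq_zero.mp h3 with h4 | h4
  · have : k = P.natDegree := by exact_mod_cast sub_eq_zero.mp h4
    exact hlc (this ▸ hk)
  · have : (0 : ℝ) < k + P.natDegree + 2 * lam := by positivity
    exact this.ne' h4

lemma natDegree_gegenPoly_le (lam : ℝ) (n : ℕ) : (gegenPoly lam n).natDegree ≤ n := by
  induction n using Nat.twoStepInduction with
  | zero => simp [gegenPoly]
  | one => exact (natDegree_C_mul_le _ _).trans natDegree_X_le
  | more n h₀ h₁ =>
    rw [gegenPoly]
    refine (natDegree_C_mul_le _ _).trans <|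
      (natDegree_sub_le_of_le (m := n + 2) (n := n + 2) ?_ ?_).trans (by simp)
    · rw [mul_assoc]
      refine (natDegree_C_mul_le _ _).trans <| natDegree_mul_le.trans ?_
      rw [natDegree_X]; omega
    · exact (natDegree_C_mul_le _ _).trans (by omega)

lemma coeff_gegenPoly_pos {lam : ℝ} (hlam : 0 < lam) (n : ℕ) : 0 < (gegenPoly lam n).coeff n := by
  induction n using Nat.twoStepInduction with
  | zero => simp [gegenPoly]
  | one => simp [gegenPoly, hlam]
  | more n h₀ h₁ =>
    have : (gegenPoly lam n).coeff (n + 1 + 1) = 0 :=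
      coeff_eq_zero_of_natDegree_lt ((natDegree_gegenPoly_le lam n).trans_lt (by omega))
    rw [gegenPoly, coeff_C_mul, coeff_sub, mul_assoc, coeff_C_mul, coeff_C_mul, coeff_X_mul, this]
    have : 0 < 2 * ((n : ℝ) + 1 + lam) * (gegenPoly lam (n + 1)).coeff (n + 1) := by positivity
    rw [mul_zero, sub_zero]
    positivity

lemma eval_one_gegenPoly_pos {lam : ℝ} (hlam : 0 < lam) (n : ℕ) :
    0 < (gegenPoly lam n).eval 1 := by
  induction n with
  | zero => simp [gegenPoly]
  | succ n ih =>
    have h := congrArg (eval 1) (one_sub_X_sq_mul_derivative_gegenPoly lam n).2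
    simp only [eval_mul, eval_sub, eval_one, eval_pow, eval_X, eval_C] at h
    have h2 : ((n : ℝ) + 1) * (gegenPoly lam (n + 1)).eval 1 =
        (n + 2 * lam) * (gegenPoly lam n).eval 1 := by linear_combination h
    have : 0 < ((n : ℝ) + 2 * lam) * (gegenPoly lam n).eval 1 := by positivity
    rw [← h2] at this
    exact pos_of_mul_pos_right this (by positivity)

/-- The Gegenbauer polynomials as a polynomial sequence. -/
def gegenSequence {lam : ℝ} (hlam : 0 < lam) : Polynomial.Sequence ℝ where
  elems' := gegenPoly lam
  degree_eq' n := by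
    refine le_antisymm (degree_le_of_natDegree_le (natDegree_gegenPoly_le lam n)) ?_
    exact le_degree_of_ne_zero (coeff_gegenPoly_pos hlam n).ne'

lemma span_range_gegenPoly {lam : ℝ} (hlam : 0 < lam) :
    Submodule.span ℝ (Set.range (gegenPoly lam)) = ⊤ :=
  (gegenSequence hlam).span fun i => by simp [(gegenSequence hlam).ne_zero]

lemma iterate_derivative_gegenOp (lam : ℝ) (g : ℝ[X]) (m : ℕ) :
    derivative^[m] (gegenOp lam g) = (1 - X ^ 2) * derivative^[m + 2] g -
      C (2 * (m : ℝ) + 2 * lam + 1) * X * derivative^[m + 1] g -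
      C ((m : ℝ) * (m + 2 * lam)) * derivative^[m] g := by
  induction m with
  | zero => simp [gegenOp_apply]
  | succ m ih =>
    rw [Function.iterate_succ_apply', ih]
    simp only [derivative_sub, derivative_mul, derivative_C, derivative_X, derivative_one,
      derivative_X_pow, ← Function.iterate_succ_apply' (⇑derivative)]
    simp only [map_add, map_mul, map_natCast, map_ofNat, map_one, Nat.cast_add, Nat.cast_one,
      Nat.succ_eq_add_one, Nat.cast_ofNat]
    norm_num
    ring

/-- The generalized translate of `g` by `y`, written in terms of the moments `M` of the averaging
measure; `N` bounds the length of the Taylor expansion. -/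
def translatePoly (M : ℕ → ℝ) (N : ℕ) (y : ℝ) : ℝ[X] →ₗ[ℝ] ℝ[X] where
  toFun g := ∑ j ∈ Finset.range N, C (M j / (2 * j).factorial * (1 - y ^ 2) ^ j) *
    (1 - X ^ 2) ^ j * (derivative^[2 * j] g).comp (C y * X)
  map_add' g h := by
    simp [iterate_map_add, mul_add, Finset.sum_add_distrib]
  map_smul' a g := by
    simp [iterate_derivative_smul, Finset.smul_sum]

lemma translatePoly_apply (M : ℕ → ℝ) (N : ℕ) (y : ℝ) (g : ℝ[X]) :
    translatePoly M N y g =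
      ∑ j ∈ Finset.range N, C (M j / (2 * j).factorial * (1 - y ^ 2) ^ j) *
        (1 - X ^ 2) ^ j * (derivative^[2 * j] g).comp (C y * X) := rfl

/-- The telescoping remainder in the commutation of `gegenOp` with `translatePoly`. -/
def translateRemainder (lam : ℝ) (M : ℕ → ℝ) (y : ℝ) (g : ℝ[X]) (j : ℕ) : ℝ[X] :=
  C (2 * (j : ℝ) * (2 * j + 2 * lam - 1) * (M j / (2 * j).factorial * (1 - y ^ 2) ^ j)) *
    (1 - X ^ 2) ^ (j - 1) * (derivative^[2 * j] g).comp (C y * X)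

lemma gegenOp_translatePoly_summand {lam : ℝ} {M : ℕ → ℝ}
    (hM : ∀ j : ℕ, (2 * (j : ℝ) + 1) * M j = (2 * j + 1 + 2 * lam) * M (j + 1))
    (y : ℝ) (g : ℝ[X]) (j : ℕ) :
    gegenOp lam (C (M j / (2 * j).factorial * (1 - y ^ 2) ^ j) * (1 - X ^ 2) ^ j *
        (derivative^[2 * j] g).comp (C y * X)) -
      C (M j / (2 * j).factorial * (1 - y ^ 2) ^ j) * (1 - X ^ 2) ^ j *
        (derivative^[2 * j] (gegenOp lam g)).comp (C y * X) =
    translateRemainder lam M y g j - translateRemainder lam M y g (j + 1) := by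
  have hder (m : ℕ) : derivative ((derivative^[m] g).comp (C y * X)) =
      C y * (derivative^[m + 1] g).comp (C y * X) := by
    rw [derivative_comp, ← Function.iterate_succ_apply' (⇑derivative)]
    simp
  have hc : 2 * ((j + 1 : ℕ) : ℝ) * (2 * (j + 1 : ℕ) + 2 * lam - 1) *
      (M (j + 1) / (2 * (j + 1)).factorial * (1 - y ^ 2) ^ (j + 1)) =
      (1 - y ^ 2) * (M j / (2 * j).factorial * (1 - y ^ 2) ^ j) := by
    have hf : ((2 * (j + 1)).factorial : ℝ) = (2 * j + 2) * ((2 * j + 1) * (2 * j).factorial) := by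
      rw [show 2 * (j + 1) = 2 * j + 1 + 1 by ring, Nat.factorial_succ, Nat.factorial_succ]
      push_cast; ring
    have hf0 : ((2 * j).factorial : ℝ) ≠ 0 := by positivity
    have h1 : (2 * (j : ℝ) + 2) ≠ 0 := by positivity
    have h2 : (2 * (j : ℝ) + 1) ≠ 0 := by positivity
    rw [hf]
    push_cast
    field_simp
    linear_combination -(1 - y ^ 2) ^ (j + 1) * hM j
  rw [translateRemainder, translateRemainder, hc, iterate_derivative_gegenOp, gegenOp_apply]
  generalize M j / (2 * j).factorial * (1 - y ^ 2) ^ j = c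
  simp only [derivative_mul, derivative_add, derivative_C, derivative_pow, derivative_sub,
    derivative_one, derivative_X, hder, sub_comp, mul_comp, one_comp, C_comp, X_comp, pow_comp,
    show 2 * (j + 1) = 2 * j + 2 by ring]
  generalize (derivative^[2 * j] g).comp (C y * X) = H₀
  generalize (derivative^[2 * j + 1] g).comp (C y * X) = H₁
  generalize (derivative^[2 * j + 1 + 1] g).comp (C y * X) = H₂
  rcases j with - | - | j
  · simp
    ring
  · simp
    simp only [map_ofNat]
    ring
  · simp only [map_add, map_sub, map_mul, map_natCast, map_ofNat, map_one, map_pow, map_zero,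
      Nat.cast_add,
      Nat.cast_one, Nat.add_sub_cancel, Nat.cast_ofNat, Nat.cast_mul]
    ring

lemma gegenOp_translatePoly {lam : ℝ} {M : ℕ → ℝ}
    (hM : ∀ j : ℕ, (2 * (j : ℝ) + 1) * M j = (2 * j + 1 + 2 * lam) * M (j + 1))
    (y : ℝ) {g : ℝ[X]} {N : ℕ} (hN : g.natDegree < 2 * N) :
    gegenOp lam (translatePoly M N y g) = translatePoly M N y (gegenOp lam g) := by
  rw [← sub_eq_zero, translatePoly_apply, translatePoly_apply, map_sum, ← Finset.sum_sub_distrib]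
  simp_rw [gegenOp_translatePoly_summand hM]
  rw [Finset.sum_range_sub']
  simp [translateRemainder, iterate_derivative_eq_zero hN]

lemma translatePoly_gegenPoly {lam : ℝ} (hlam : 0 < lam) {M : ℕ → ℝ}
    (hM : ∀ j : ℕ, (2 * (j : ℝ) + 1) * M j = (2 * j + 1 + 2 * lam) * M (j + 1)) (hM0 : M 0 = 1)
    (y : ℝ) {k N : ℕ} (hN : k < 2 * N) :
    translatePoly M N y (gegenPoly lam k) =
      C ((gegenPoly lam k).eval y / (gegenPoly lam k).eval 1) * gegenPoly lam k := by
  set P := translatePoly M N y (gegenPoly lam k)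
  have hP : gegenOp lam P = C (-((k : ℝ) * (k + 2 * lam))) * P := by
    rw [gegenOp_translatePoly hM y ((natDegree_gegenPoly_le lam k).trans_lt hN),
      gegenOp_gegenPoly, ← smul_eq_C_mul, map_smul, smul_eq_C_mul]
  obtain ⟨a, ha⟩ : ∃ a : ℝ, P = C a * gegenPoly lam k := by
    refine ⟨P.coeff k / (gegenPoly lam k).coeff k, ?_⟩
    rw [← sub_eq_zero]
    refine eq_zero_of_gegenOp_eq hlam (k := k) ?_ ?_
    · rw [map_sub, hP, ← smul_eq_C_mul (P.coeff k / _), map_smul, gegenOp_gegenPoly,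
        smul_eq_C_mul, smul_eq_C_mul]
      ring
    · rw [coeff_sub, coeff_C_mul, div_mul_cancel₀ _ (coeff_gegenPoly_pos hlam k).ne', sub_self]
  have h1 : P.eval 1 = (gegenPoly lam k).eval y := by
    obtain ⟨N, rfl⟩ : ∃ m, N = m + 1 := ⟨N - 1, by omega⟩
    simp [P, translatePoly_apply, eval_finsetSum, Finset.sum_range_succ', hM0]
  rw [ha, ← h1, ha, eval_mul, eval_C, mul_div_cancel_right₀ _ (eval_one_gegenPoly_pos hlam k).ne']

lemma integrableOn_weight {a : ℝ} (ha : -1 < a) :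
    IntegrableOn (fun t : ℝ => (1 - t ^ 2) ^ a) (Set.Ioo (-1) 1) := by
  have h := Complex.betaIntegral_convergent (u := ((a + 1 : ℝ) : ℂ)) (v := ((a + 1 : ℝ) : ℂ))
    (by simpa using by linarith) (by simpa using by linarith)
  have h2 := (h.norm.comp_add_right (1 / 2)).comp_mul_left (c := (2 : ℝ)⁻¹)
  have h3 := h2.const_mul ((4 : ℝ) ^ a)
  norm_num at h3
  rw [intervalIntegrable_iff_integrableOn_Ioo_of_le (by norm_num)] at h3
  refine h3.congr_fun (fun t ht => ?_) measurableSet_Ioo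
  obtain ⟨h₁, h₂⟩ := ht
  have e1 : (1 / 2 * (t : ℂ) + 1 / 2) = ((1 / 2 * t + 1 / 2 : ℝ) : ℂ) := by push_cast; ring
  have e2 : (1 - (1 / 2 * (t : ℂ) + 1 / 2)) = ((1 - (1 / 2 * t + 1 / 2) : ℝ) : ℂ) := by
    push_cast; ring
  dsimp only
  rw [e2, e1, Complex.norm_real, Complex.norm_real, Real.norm_of_nonneg (by linarith),
    Real.norm_of_nonneg (by linarith),
    ← Real.mul_rpow (by linarith) (by linarith), ← Real.mul_rpow (by norm_num) (by nlinarith)]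
  congr 1
  ring

lemma wM_univ_ne_top {κ : ℝ} (hκ : -1 / 2 < κ) : wM κ Set.univ ≠ ∞ := by
  rw [wM, withDensity_apply _ MeasurableSet.univ, Measure.restrict_univ]
  exact (integrableOn_weight (a := κ - 1 / 2) (by linarith)).lintegral_lt_top.ne

lemma wM_univ_ne_zero (κ : ℝ) : wM κ Set.univ ≠ 0 := by
  rw [wM, withDensity_apply _ MeasurableSet.univ, Measure.restrict_univ]
  refine (setLIntegral_pos_iff (by fun_prop) |>.mpr ?_).ne'
  refine lt_of_lt_of_le (b := volume (Set.Ioo (-1 : ℝ) 1)) (by simp) (measure_mono fun t ht => ?_)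
  refine ⟨?_, ht⟩
  rw [Function.mem_support, ne_eq, ENNReal.ofReal_eq_zero, not_le]
  exact Real.rpow_pos_of_pos (by nlinarith [ht.1, ht.2]) _

lemma isProbabilityMeasure_νm {κ : ℝ} (hκ : -1 / 2 < κ) : IsProbabilityMeasure (νm κ) := by
  constructor
  rw [νm, Measure.smul_apply, smul_eq_mul,
    ENNReal.inv_mul_cancel (wM_univ_ne_zero κ) (wM_univ_ne_top hκ)]

lemma ae_νm_mem_Ioo (κ : ℝ) : ∀ᵐ t ∂νm κ, t ∈ Set.Ioo (-1 : ℝ) 1 := by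
  refine Measure.ae_smul_measure ?_ _
  exact (withDensity_absolutelyContinuous _ _).ae_le (ae_restrict_mem measurableSet_Ioo)

lemma integral_νm (κ : ℝ) (f : ℝ → ℝ) :
    ∫ t, f t ∂νm κ =
      (wM κ Set.univ)⁻¹.toReal * ∫ t in Set.Ioo (-1 : ℝ) 1, (1 - t ^ 2) ^ (κ - 1 / 2) * f t := by
  rw [νm, integral_smul_measure, smul_eq_mul, wM,
    integral_withDensity_eq_integral_toReal_smul (by fun_prop) (by simp)]
  congr 1
  refine setIntegral_congr_fun measurableSet_Ioo fun t ht => ?_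
  rw [ENNReal.toReal_ofReal (Real.rpow_nonneg (by nlinarith [ht.1, ht.2]) _), smul_eq_mul]

lemma integrable_νm {κ : ℝ} (hκ : -1 / 2 < κ) {f : ℝ → ℝ} (hf : Continuous f) :
    Integrable f (νm κ) := by
  have := isProbabilityMeasure_νm hκ
  obtain ⟨K, hK⟩ := (isCompact_Icc (a := (-1 : ℝ)) (b := 1)).exists_bound_of_continuousOn
    hf.continuousOn
  exact Integrable.of_bound hf.aestronglyMeasurable K
    ((ae_νm_mem_Ioo κ).mono fun t ht => hK t ⟨ht.1.le, ht.2.le⟩)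

/-- Integration by parts: `∫ (1 - t²)^{κ-1/2} ((1 - t²) Q' - (2κ+1) t Q) dt = 0`. -/
lemma integral_νm_eq_zero {κ : ℝ} (hκ : -1 / 2 < κ) (Q : ℝ[X]) :
    ∫ t, ((1 - t ^ 2) * (derivative Q).eval t - (2 * κ + 1) * t * Q.eval t) ∂νm κ = 0 := by
  rw [integral_νm]
  have h_int : IntervalIntegrable (fun t : ℝ => (1 - t ^ 2) ^ (κ - 1 / 2) *
      ((1 - t ^ 2) * (derivative Q).eval t - (2 * κ + 1) * t * Q.eval t)) volume (-1) 1 := by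
    rw [intervalIntegrable_iff_integrableOn_Icc_of_le (by norm_num)]
    refine IntegrableOn.mul_continuousOn ?_ (by fun_prop) isCompact_Icc
    rw [integrableOn_Icc_iff_integrableOn_Ioo]
    exact integrableOn_weight (by linarith)
  have h := intervalIntegral.integral_eq_sub_of_hasDerivAt_of_le (a := -1) (b := 1)
    (f := fun t : ℝ => (1 - t ^ 2) ^ (κ + 1 / 2) * Q.eval t) (by norm_num) ?_ ?_ h_int
  · rw [intervalIntegral.integral_of_le (by norm_num), integral_Ioc_eq_integral_Ioo] at h
    rw [h]
    norm_num [Real.zero_rpow (show κ + 1 / 2 ≠ 0 by linarith)]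
  · have : 0 ≤ κ + 1 / 2 := by linarith
    fun_prop (disch := assumption)
  · intro t ht
    have hpos : 0 < 1 - t ^ 2 := by nlinarith [ht.1, ht.2]
    have h1 : HasDerivAt (fun t : ℝ => 1 - t ^ 2) (-(2 * t)) t := by
      simpa using (hasDerivAt_pow 2 t).const_sub 1
    refine ((h1.rpow_const (p := κ + 1 / 2) (.inl hpos.ne')).mul (Q.hasDerivAt t)).congr_deriv ?_
    rw [show κ + 1 / 2 - 1 = κ - 1 / 2 by ring, show κ + 1 / 2 = (κ - 1 / 2) + 1 by ring,
      Real.rpow_add_one hpos.ne']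
    ring

lemma integral_νm_gegenOp {lam : ℝ} (hlam : 0 < lam) (P : ℝ[X]) :
    ∫ t, (gegenOp lam P).eval t ∂νm lam = 0 := by
  rw [← integral_νm_eq_zero (κ := lam) (by linarith) (derivative P)]
  simp [gegenOp_apply]

lemma integral_νm_gegenPoly {lam : ℝ} (hlam : 0 < lam) {k : ℕ} (hk : k ≠ 0) :
    ∫ t, (gegenPoly lam k).eval t ∂νm lam = 0 := by
  have h := integral_νm_gegenOp hlam (gegenPoly lam k)
  simp only [gegenOp_gegenPoly, eval_mul, eval_C] at h
  rw [integral_const_mul] at h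
  refine (mul_eq_zero.mp h).resolve_left ?_
  have : (0 : ℝ) < k := by positivity
  exact neg_ne_zero.mpr (by positivity)

lemma moment_νm_recurrence {lam : ℝ} (hlam : 0 < lam) (m : ℕ) :
    ((m : ℝ) + 1) * ∫ s, s ^ m ∂νm (lam - 1 / 2) =
      (m + 1 + 2 * lam) * ∫ s, s ^ (m + 2) ∂νm (lam - 1 / 2) := by
  have hκ : -1 / 2 < lam - 1 / 2 := by linarith
  have h := integral_νm_eq_zero hκ (X ^ (m + 1))
  rw [← sub_eq_zero, ← integral_const_mul, ← integral_const_mul, ← integral_sub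
    (integrable_νm hκ (by fun_prop)) (integrable_νm hκ (by fun_prop)), ← h]
  congr 1 with s
  simp
  ring

lemma odd_moment_νm {lam : ℝ} (hlam : 0 < lam) (j : ℕ) :
    ∫ s, s ^ (2 * j + 1) ∂νm (lam - 1 / 2) = 0 := by
  induction j with
  | zero =>
    have h := integral_νm_eq_zero (κ := lam - 1 / 2) (by linarith) 1
    simp only [derivative_one, eval_zero, eval_one, mul_zero, mul_one, zero_sub] at h
    rw [integral_neg, integral_const_mul, neg_eq_zero] at h
    simpa using (mul_eq_zero.mp h).resolve_left (by linarith)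
  | succ j ih =>
    have h := moment_νm_recurrence hlam (2 * j + 1)
    rw [ih, mul_zero] at h
    exact (mul_eq_zero.mp h.symm).resolve_left (by positivity)

/-- The argument of the generalized translation: if `x = cos θ`, `y = cos φ`, this is
`cos θ cos φ + s sin θ sin φ`. -/
def translateArg (y x s : ℝ) : ℝ := x * y + √(1 - x ^ 2) * √(1 - y ^ 2) * s

lemma continuous_translateArg (y : ℝ) : Continuous fun q : ℝ × ℝ => translateArg y q.1 q.2 := by
  unfold translateArg; fun_prop

lemma translateArg_mem_Icc {x y s : ℝ} (hx : x ∈ Set.Icc (-1 : ℝ) 1) (hy : y ∈ Set.Icc (-1 : ℝ) 1)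
    (hs : s ∈ Set.Icc (-1 : ℝ) 1) : translateArg y x s ∈ Set.Icc (-1 : ℝ) 1 := by
  have hx2 : 0 ≤ 1 - x ^ 2 := by nlinarith [hx.1, hx.2]
  have hy2 : 0 ≤ 1 - y ^ 2 := by nlinarith [hy.1, hy.2]
  have h1 := Real.sq_sqrt hx2
  have h2 := Real.sq_sqrt hy2
  have h3 := Real.sqrt_nonneg (1 - x ^ 2)
  have h4 := Real.sqrt_nonneg (1 - y ^ 2)
  unfold translateArg
  set a := √(1 - x ^ 2)
  set b := √(1 - y ^ 2)
  have hab := mul_nonneg h3 h4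
  constructor <;> nlinarith [sq_nonneg (x + y), sq_nonneg (a - b), sq_nonneg (x - y),
    mul_nonneg hab (sub_nonneg.mpr hs.2), mul_nonneg hab (sub_nonneg.mpr hs.1)]

lemma sum_range_two_mul (f : ℕ → ℝ) (N : ℕ) :
    ∑ m ∈ Finset.range (2 * N), f m = ∑ j ∈ Finset.range N, (f (2 * j) + f (2 * j + 1)) := by
  induction N with
  | zero => simp
  | succ N ih =>
    rw [show 2 * (N + 1) = 2 * N + 1 + 1 by ring, Finset.sum_range_succ, Finset.sum_range_succ, ih,
      Finset.sum_range_succ]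
    ring

lemma eval_add_eq_sum (g : ℝ[X]) {N : ℕ} (hN : g.natDegree < N) (a u : ℝ) :
    g.eval (a + u) = ∑ m ∈ Finset.range N, (derivative^[m] g).eval a / m.factorial * u ^ m := by
  have h := taylor_eval a g u
  rw [add_comm, ← h, eval_eq_sum_range' (n := N) (by rwa [natDegree_taylor])]
  refine Finset.sum_congr rfl fun m _ => ?_
  rw [taylor_coeff, ← factorial_smul_hasseDeriv]
  rw [LinearMap.smul_apply, eval_smul, nsmul_eq_mul]
  have : (m.factorial : ℝ) ≠ 0 := by positivity
  field_simp

lemma integral_translateArg_eq_eval_translatePoly {lam : ℝ} (hlam : 0 < lam) {g : ℝ[X]} {N : ℕ}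
    (hN : g.natDegree < 2 * N) {x y : ℝ} (hx : x ∈ Set.Icc (-1 : ℝ) 1)
    (hy : y ∈ Set.Icc (-1 : ℝ) 1) :
    ∫ s, g.eval (translateArg y x s) ∂νm (lam - 1 / 2) =
      (translatePoly (fun j => ∫ s, s ^ (2 * j) ∂νm (lam - 1 / 2)) N y g).eval x := by
  have hκ : -1 / 2 < lam - 1 / 2 := by linarith
  simp_rw [translateArg, eval_add_eq_sum g hN, mul_pow _ (_ : ℝ)]
  rw [integral_finsetSum _ fun m _ => integrable_νm hκ (by fun_prop), sum_range_two_mul,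
    translatePoly_apply, eval_finsetSum]
  refine Finset.sum_congr rfl fun j _ => ?_
  simp only [← mul_assoc]
  rw [integral_const_mul, integral_const_mul, odd_moment_νm hlam, mul_zero, add_zero]
  have hx2 : 0 ≤ 1 - x ^ 2 := by nlinarith [hx.1, hx.2]
  have hy2 : 0 ≤ 1 - y ^ 2 := by nlinarith [hy.1, hy.2]
  rw [pow_mul √(1 - x ^ 2), pow_mul √(1 - y ^ 2), Real.sq_sqrt hx2, Real.sq_sqrt hy2]
  simp [eval_comp, mul_comm y x]
  ring

/-- Gegenbauer's product formula. -/
lemma integral_gegenPoly_translateArg {lam : ℝ} (hlam : 0 < lam) (k : ℕ) {x y : ℝ}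
    (hx : x ∈ Set.Icc (-1 : ℝ) 1) (hy : y ∈ Set.Icc (-1 : ℝ) 1) :
    ∫ s, (gegenPoly lam k).eval (translateArg y x s) ∂νm (lam - 1 / 2) =
      (gegenPoly lam k).eval y / (gegenPoly lam k).eval 1 * (gegenPoly lam k).eval x := by
  have := isProbabilityMeasure_νm (κ := lam - 1 / 2) (by linarith)
  have hN : k < 2 * (k + 1) := by omega
  rw [integral_translateArg_eq_eval_translatePoly hlam
    ((natDegree_gegenPoly_le lam k).trans_lt hN) hx hy,
    translatePoly_gegenPoly hlam (fun j => ?_) (by simp [-one_div]) y hN, eval_mul, eval_C]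
  simpa [mul_add] using moment_νm_recurrence hlam (2 * j)

lemma measure_ext_of_integral_polynomial {μ ν : Measure ℝ} [IsProbabilityMeasure μ]
    [IsProbabilityMeasure ν] (hμ : ∀ᵐ t ∂μ, t ∈ Set.Icc (-1 : ℝ) 1)
    (hν : ∀ᵐ t ∂ν, t ∈ Set.Icc (-1 : ℝ) 1)
    (h : ∀ P : ℝ[X], ∫ t, P.eval t ∂μ = ∫ t, P.eval t ∂ν) : μ = ν := by
  refine ext_of_forall_integral_eq_of_IsFiniteMeasure fun f => ?_
  have key (ρ : Measure ℝ) [IsProbabilityMeasure ρ] (hρ : ∀ᵐ t ∂ρ, t ∈ Set.Icc (-1 : ℝ) 1)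
      (P : ℝ[X]) (ε : ℝ) (hP : ∀ x ∈ Set.Icc (-1 : ℝ) 1, |P.eval x - f x| < ε) :
      |∫ t, P.eval t ∂ρ - ∫ t, f t ∂ρ| ≤ ε := by
    obtain ⟨K, hK⟩ := (isCompact_Icc (a := (-1 : ℝ)) (b := 1)).exists_bound_of_continuousOn
      P.continuous.continuousOn
    rw [← integral_sub (Integrable.of_bound P.continuous.aestronglyMeasurable K (hρ.mono hK))
      (f.integrable ρ)]
    simpa using norm_integral_le_of_norm_le_const (μ := ρ) (f := fun t => P.eval t - f t)
      (hρ.mono fun t ht => (hP t ht).le)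
  rw [← sub_eq_zero, ← abs_nonpos_iff]
  refine le_of_forall_pos_le_add fun ε hε => ?_
  obtain ⟨P, hP⟩ := exists_polynomial_near_of_continuousOn (-1) 1 f f.continuous.continuousOn
    (ε / 2) (by positivity)
  have h1 := abs_le.mp (key μ hμ P _ hP)
  have h2 := abs_le.mp (key ν hν P _ hP)
  rw [h P] at h1
  rw [abs_le]
  constructor <;> linarith [h1.1, h1.2, h2.1, h2.2]

lemma measurePreserving_translateArg {lam : ℝ} (hlam : 0 < lam) {y : ℝ}
    (hy : y ∈ Set.Icc (-1 : ℝ) 1) :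
    MeasurePreserving (fun q : ℝ × ℝ => translateArg y q.1 q.2)
      ((νm lam).prod (νm (lam - 1 / 2))) (νm lam) := by
  have := isProbabilityMeasure_νm (κ := lam) (by linarith)
  have := isProbabilityMeasure_νm (κ := lam - 1 / 2) (by linarith)
  have hcont := continuous_translateArg y
  refine ⟨hcont.measurable, ?_⟩
  have := Measure.isProbabilityMeasure_map (μ := (νm lam).prod (νm (lam - 1 / 2)))
    hcont.measurable.aemeasurable
  have hmem : ∀ᵐ q ∂(νm lam).prod (νm (lam - 1 / 2)),
      translateArg y q.1 q.2 ∈ Set.Icc (-1 : ℝ) 1 := by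
    filter_upwards [Measure.quasiMeasurePreserving_fst.ae (ae_νm_mem_Ioo lam),
      Measure.quasiMeasurePreserving_snd.ae (ae_νm_mem_Ioo (lam - 1 / 2))] with q h1 h2
    exact translateArg_mem_Icc (Set.Ioo_subset_Icc_self h1) hy (Set.Ioo_subset_Icc_self h2)
  have hmem' : ∀ᵐ t ∂((νm lam).prod (νm (lam - 1 / 2))).map
      (fun q : ℝ × ℝ => translateArg y q.1 q.2), t ∈ Set.Icc (-1 : ℝ) 1 :=
    (ae_map_iff hcont.measurable.aemeasurable measurableSet_Icc).mpr hmem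
  have h_int (P : ℝ[X]) : Integrable (fun t => P.eval t)
      (((νm lam).prod (νm (lam - 1 / 2))).map (fun q : ℝ × ℝ => translateArg y q.1 q.2)) := by
    obtain ⟨K, hK⟩ := (isCompact_Icc (a := (-1 : ℝ)) (b := 1)).exists_bound_of_continuousOn
      P.continuous.continuousOn
    exact Integrable.of_bound P.continuous.aestronglyMeasurable K (hmem'.mono hK)
  refine measure_ext_of_integral_polynomial hmem'
    ((ae_νm_mem_Ioo lam).mono fun t ht => Set.Ioo_subset_Icc_self ht) fun P => ?_
  have hP : P ∈ Submodule.span ℝ (Set.range (gegenPoly lam)) := by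
    rw [span_range_gegenPoly hlam]; trivial
  induction hP using Submodule.span_induction with
  | mem P hP =>
    obtain ⟨k, rfl⟩ := hP
    rcases eq_or_ne k 0 with rfl | hk
    · simp [gegenPoly, -one_div]
    · have hi : Integrable (fun q : ℝ × ℝ => (gegenPoly lam k).eval (translateArg y q.1 q.2))
          ((νm lam).prod (νm (lam - 1 / 2))) :=
        (integrable_map_measure (gegenPoly lam k).continuous.aestronglyMeasurable
          hcont.measurable.aemeasurable).mp (h_int _)
      rw [integral_νm_gegenPoly hlam hk, integral_map hcont.measurable.aemeasurable
        (gegenPoly lam k).continuous.aestronglyMeasurable,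
        integral_prod _ hi]
      rw [integral_congr_ae ((ae_νm_mem_Ioo lam).mono fun x hx =>
        integral_gegenPoly_translateArg hlam k (Set.Ioo_subset_Icc_self hx) hy),
        integral_const_mul, integral_νm_gegenPoly hlam hk, mul_zero]
  | zero => simp
  | add P Q _ _ hP hQ =>
    simp only [eval_add]
    rw [integral_add (h_int P) (h_int Q),
      integral_add (integrable_νm (by linarith) P.continuous)
        (integrable_νm (by linarith) Q.continuous), hP, hQ]
  | smul a P _ hP =>
    simp only [eval_smul]
    rw [integral_smul, integral_smul, hP]

lemma eLpNorm_integral_le_eLpNorm_prod {α β : Type*} [MeasurableSpace α] [MeasurableSpace β]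
    {μ : Measure α} {ν : Measure β} [SFinite μ] [IsProbabilityMeasure ν] {F : α × β → ℝ}
    (hF : AEStronglyMeasurable F (μ.prod ν)) {p : ℝ≥0∞} (hp : 1 ≤ p) :
    eLpNorm (fun x => ∫ s, F (x, s) ∂ν) p μ ≤ eLpNorm F p (μ.prod ν) := by
  have h1 (x : α) : ‖∫ s, F (x, s) ∂ν‖ₑ ≤ eLpNorm (fun s => F (x, s)) 1 ν := by
    rw [eLpNorm_one_eq_lintegral_enorm]
    exact enorm_integral_le_lintegral_enorm _
  have h2 : ∀ᵐ x ∂μ, ‖∫ s, F (x, s) ∂ν‖ₑ ≤ eLpNorm (fun s => F (x, s)) p ν := by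
    filter_upwards [hF.prodMk_left] with x hx
    exact (h1 x).trans (eLpNorm_le_eLpNorm_of_exponent_le hp hx)
  rcases eq_or_ne p ∞ with rfl | hp'
  · rw [eLpNorm_exponent_top, eLpNorm_exponent_top]
    refine eLpNormEssSup_le_of_ae_enorm_bound ?_
    have h3 := Measure.ae_ae_of_ae_prod (ae_le_eLpNormEssSup (f := F) (μ := μ.prod ν))
    filter_upwards [h2, h3] with x hx hx'
    rw [eLpNorm_exponent_top] at hx
    exact hx.trans (eLpNormEssSup_le_of_ae_enorm_bound hx')
  · have hp0 : p ≠ 0 := (zero_lt_one.trans_le hp).ne'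
    have hpr : 0 < p.toReal := ENNReal.toReal_pos hp0 hp'
    rw [eLpNorm_eq_lintegral_rpow_enorm_toReal hp0 hp',
      eLpNorm_eq_lintegral_rpow_enorm_toReal hp0 hp',
      lintegral_prod _ (hF.enorm.pow_const _)]
    gcongr ?_ ^ _
    refine lintegral_mono_ae (h2.mono fun x hx => ?_)
    rw [eLpNorm_eq_lintegral_rpow_enorm_toReal hp0 hp', one_div,
      ENNReal.le_rpow_inv_iff hpr] at hx
    exact hx

lemma integral_sum_gegenPoly_translateArg {lam : ℝ} (hlam : 0 < lam) (n : ℕ) (b : ℕ → ℝ) {x y : ℝ}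
    (hx : x ∈ Set.Icc (-1 : ℝ) 1) (hy : y ∈ Set.Icc (-1 : ℝ) 1) :
    ∫ s, ∑ k ∈ Finset.range n, b k * (gegenPoly lam k).eval (translateArg y x s)
        ∂νm (lam - 1 / 2) =
      ∑ k ∈ Finset.range n, b k * ((gegenPoly lam k).eval y / (gegenPoly lam k).eval 1) *
        (gegenPoly lam k).eval x := by
  have hc : Continuous fun s => translateArg y x s :=
    (continuous_translateArg y).comp (by fun_prop : Continuous fun s : ℝ => (x, s))
  have hi (k : ℕ) : Integrable (fun s => b k * (gegenPoly lam k).eval (translateArg y x s))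
      (νm (lam - 1 / 2)) :=
    integrable_νm (by linarith) (continuous_const.mul ((gegenPoly lam k).continuous.comp hc))
  rw [integral_finsetSum _ fun k _ => hi k]
  refine Finset.sum_congr rfl fun k _ => ?_
  rw [integral_const_mul, integral_gegenPoly_translateArg hlam k hx hy, mul_assoc]

/-- The generalized translation is a contraction on `L^p`. -/
lemma eLpNorm_translate_le {lam : ℝ} (hlam : 0 < lam) (n : ℕ) (b : ℕ → ℝ) {y : ℝ}
    (hy : y ∈ Set.Icc (-1 : ℝ) 1) {p : ℝ≥0∞} (hp : 1 ≤ p) :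
    eLpNorm (fun x => ∑ k ∈ Finset.range n,
        b k * ((gegenPoly lam k).eval y / (gegenPoly lam k).eval 1) * (gegenPoly lam k).eval x)
        p (νm lam) ≤
      eLpNorm (fun x => ∑ k ∈ Finset.range n, b k * (gegenPoly lam k).eval x) p (νm lam) := by
  have := isProbabilityMeasure_νm (κ := lam) (by linarith)
  have := isProbabilityMeasure_νm (κ := lam - 1 / 2) (by linarith)
  have hmp := measurePreserving_translateArg hlam hy
  have hcont : Continuous fun x => ∑ k ∈ Finset.range n, b k * (gegenPoly lam k).eval x := by
    fun_prop
  rw [← eLpNorm_comp_measurePreserving hcont.aestronglyMeasurable hmp]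
  refine le_trans (le_of_eq ?_) (eLpNorm_integral_le_eLpNorm_prod
    (hcont.comp (continuous_translateArg y)).aestronglyMeasurable hp)
  refine eLpNorm_congr_ae ((ae_νm_mem_Ioo lam).mono fun x hx => ?_)
  exact (integral_sum_gegenPoly_translateArg hlam n b (Set.Ioo_subset_Icc_self hx) hy).symm

/-- The generalized translation is a contraction for the uniform norm. -/
lemma abs_translate_le {lam : ℝ} (hlam : 0 < lam) {n : ℕ} {b : ℕ → ℝ} {K : ℝ}
    (hK : ∀ x ∈ Set.Icc (-1 : ℝ) 1, |∑ k ∈ Finset.range n, b k * (gegenPoly lam k).eval x| ≤ K)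
    {x y : ℝ} (hx : x ∈ Set.Icc (-1 : ℝ) 1) (hy : y ∈ Set.Icc (-1 : ℝ) 1) :
    |∑ k ∈ Finset.range n, b k * ((gegenPoly lam k).eval y / (gegenPoly lam k).eval 1) *
      (gegenPoly lam k).eval x| ≤ K := by
  have := isProbabilityMeasure_νm (κ := lam - 1 / 2) (by linarith)
  rw [← integral_sum_gegenPoly_translateArg hlam n b hx hy]
  simpa [-one_div] using norm_integral_le_of_norm_le_const (μ := νm (lam - 1 / 2))
    (f := fun s => ∑ k ∈ Finset.range n, b k * (gegenPoly lam k).eval (translateArg y x s))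
    ((ae_νm_mem_Ioo _).mono fun s hs =>
      hK _ (translateArg_mem_Icc hx hy (Set.Ioo_subset_Icc_self hs)))

lemma eval_gegenOp_nonpos_of_isMaxOn {lam : ℝ} (hlam : 0 < lam) {P : ℝ[X]} {x : ℝ}
    (hx : x ∈ Set.Icc (-1 : ℝ) 1) (hmax : IsMaxOn (fun t => P.eval t) (Set.Icc (-1 : ℝ) 1) x) :
    (gegenOp lam P).eval x ≤ 0 := by
  have hdir (z : ℝ) (hz : z ∈ Set.Icc (-1 : ℝ) 1) : (z - x) * P.derivative.eval x ≤ 0 := by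
    have := hmax.localize.hasFDerivWithinAt_nonpos
      (P.hasDerivAt x).hasFDerivAt.hasFDerivWithinAt
      (sub_mem_posTangentConeAt_of_segment_subset ((convex_Icc _ _).segment_subset hx hz))
    simpa using this
  have h1 := hdir 1 (by norm_num)
  have h2 := hdir (-1) (by norm_num)
  simp only [gegenOp_apply, eval_sub, eval_mul, eval_one, eval_pow, eval_X, eval_C]
  rcases eq_or_lt_of_le hx.1 with rfl | hx1
  · nlinarith
  rcases eq_or_lt_of_le hx.2 with rfl | hx2
  · nlinarith
  have hd : P.derivative.eval x = 0 := by nlinarith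
  have hdd : P.derivative.derivative.eval x ≤ 0 := by
    by_contra! hpos
    have hderiv : deriv (fun t => P.eval t) = fun t => P.derivative.eval t := by
      ext t; exact P.deriv
    have hderiv2 : deriv (deriv fun t => P.eval t) x = P.derivative.derivative.eval x := by
      rw [hderiv]; exact P.derivative.deriv
    have hmin := isLocalMin_of_deriv_deriv_pos (f := fun t => P.eval t) (x₀ := x)
      (by rw [hderiv2]; exact hpos) (by rw [hderiv]; exact hd) P.continuous.continuousAt
    have hmax' : IsLocalMax (fun t => P.eval t) x :=
      hmax.isLocalMax (Icc_mem_nhds hx1 hx2)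
    have hconst : (fun t => P.eval t) =ᶠ[nhds x] fun _ => P.eval x := by
      filter_upwards [hmin, hmax'] with t ht ht'
      exact le_antisymm ht' ht
    have := hconst.deriv.deriv_eq
    rw [hderiv2] at this
    simp only [deriv_const', deriv_const] at this
    exact hpos.ne' this
  rw [hd, mul_zero, sub_zero]
  exact mul_nonpos_of_nonneg_of_nonpos (by nlinarith) hdd

/-- The maximum principle for `s - Λ`. -/
lemma eval_le_of_smul_sub_gegenOp_le {lam : ℝ} (hlam : 0 < lam) {s M : ℝ} (hs : 0 < s) {P : ℝ[X]}
    (hP : ∀ x ∈ Set.Icc (-1 : ℝ) 1, s * P.eval x - (gegenOp lam P).eval x ≤ s * M) {x : ℝ}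
    (hx : x ∈ Set.Icc (-1 : ℝ) 1) : P.eval x ≤ M := by
  obtain ⟨z, hz, hmax⟩ := isCompact_Icc.exists_isMaxOn ⟨x, hx⟩ P.continuous.continuousOn
  have h1 := eval_gegenOp_nonpos_of_isMaxOn hlam hz hmax
  have h2 : P.eval z ≤ M := le_of_mul_le_mul_left (by linarith [hP z hz]) hs
  exact (hmax hx).trans h2

/-- The polynomial `∑_{k < n} b_k C_k`. -/
def gegenSum (lam : ℝ) (n : ℕ) (b : ℕ → ℝ) : ℝ[X] :=
  ∑ k ∈ Finset.range n, C (b k) * gegenPoly lam k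

lemma eval_gegenSum (lam : ℝ) (n : ℕ) (b : ℕ → ℝ) (x : ℝ) :
    (gegenSum lam n b).eval x = ∑ k ∈ Finset.range n, b k * (gegenPoly lam k).eval x := by
  simp [gegenSum, eval_finsetSum]

lemma eval_gegenOp_gegenSum (lam : ℝ) (n : ℕ) (b : ℕ → ℝ) (x : ℝ) :
    (gegenOp lam (gegenSum lam n b)).eval x =
      -∑ k ∈ Finset.range n, b k * ((k : ℝ) * (k + 2 * lam)) * (gegenPoly lam k).eval x := by
  simp only [gegenSum, map_sum, ← smul_eq_C_mul, map_smul, gegenOp_gegenPoly, eval_finsetSum,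
    eval_smul, smul_eq_mul, ← Finset.sum_neg_distrib]
  exact Finset.sum_congr rfl fun k _ => by ring

/-- The functional `∑_{k < n} b_k C_k ↦ ∑_{k < n} b_k a_k C_k(1)` has norm at most `K` for the
uniform norm. -/
def EndpointBound (lam : ℝ) (n : ℕ) (a : ℕ → ℝ) (K : ℝ) : Prop :=
  ∀ (b : ℕ → ℝ) (M : ℝ),
    (∀ x ∈ Set.Icc (-1 : ℝ) 1, |∑ k ∈ Finset.range n, b k * (gegenPoly lam k).eval x| ≤ M) →
      |∑ k ∈ Finset.range n, b k * a k * (gegenPoly lam k).eval 1| ≤ K * M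

lemma EndpointBound.abs_sum_le {lam : ℝ} (hlam : 0 < lam) {n : ℕ} {a : ℕ → ℝ} {K : ℝ}
    (ha : EndpointBound lam n a K) {b : ℕ → ℝ} {M : ℝ}
    (hb : ∀ x ∈ Set.Icc (-1 : ℝ) 1, |∑ k ∈ Finset.range n, b k * (gegenPoly lam k).eval x| ≤ M)
    {y : ℝ} (hy : y ∈ Set.Icc (-1 : ℝ) 1) :
    |∑ k ∈ Finset.range n, b k * a k * (gegenPoly lam k).eval y| ≤ K * M := by
  convert ha (fun k => b k * ((gegenPoly lam k).eval y / (gegenPoly lam k).eval 1)) M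
    fun x hx => abs_translate_le hlam hb hx hy using 3 with k
  have := (eval_one_gegenPoly_pos hlam k).ne'
  field_simp

lemma EndpointBound.mul {lam : ℝ} (hlam : 0 < lam) {n : ℕ} {a₁ a₂ : ℕ → ℝ} {K₁ K₂ : ℝ}
    (h₁ : EndpointBound lam n a₁ K₁) (h₂ : EndpointBound lam n a₂ K₂) :
    EndpointBound lam n (fun k => a₁ k * a₂ k) (K₁ * K₂) := by
  intro b M hb
  convert h₂ _ _ fun y hy => h₁.abs_sum_le hlam hb hy using 1
  · simp only [mul_assoc]
  · ring

lemma endpointBound_one {lam : ℝ} (n : ℕ) : EndpointBound lam n (fun _ => 1) 1 := fun b M hb => by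
  simpa using hb 1 (by norm_num)

lemma EndpointBound.pow {lam : ℝ} (hlam : 0 < lam) {n : ℕ} {a : ℕ → ℝ} {K : ℝ}
    (h : EndpointBound lam n a K) (r : ℕ) :
    EndpointBound lam n (fun k => a k ^ r) (K ^ r) := by
  induction r with
  | zero => simpa using endpointBound_one n
  | succ r ih => simpa only [pow_succ] using ih.mul hlam h

/-- Markov's inequality at the endpoint `1`. -/
lemma abs_derivative_eval_one_le {n : ℕ} {Q : ℝ[X]} (hQ : Q.degree ≤ n) {M : ℝ}
    (hM : ∀ x ∈ Set.Icc (-1 : ℝ) 1, |Q.eval x| ≤ M) :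
    |Q.derivative.eval 1| ≤ (n : ℝ) ^ 2 * M := by
  have key (P : ℝ[X]) (hP : P.degree ≤ n) (N : ℝ) (hN : 0 < N)
      (hPN : ∀ x ∈ Set.Icc (-1 : ℝ) 1, |P.eval x| ≤ N) : P.derivative.eval 1 ≤ (n : ℝ) ^ 2 * N := by
    have h := Chebyshev.eval_iterate_derivative_le_of_forall_abs_le_one (n := n)
      (P := N⁻¹ • P) (k := 1) le_rfl ((degree_smul_le _ _).trans hP) fun x hx => by
        rw [eval_smul, smul_eq_mul, abs_mul, abs_of_pos (inv_pos.mpr hN), inv_mul_le_one₀ hN]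
        exact hPN x hx
    simp only [Function.iterate_one, derivative_smul, eval_smul, smul_eq_mul,
      Chebyshev.derivative_T_eval_one, inv_mul_le_iff₀ hN] at h
    push_cast at h
    linarith
  have hM0 : 0 ≤ M := (abs_nonneg _).trans (hM 0 (by norm_num))
  refine le_of_forall_pos_le_add fun ε hε => ?_
  obtain ⟨N, hN0, hNM, hNε⟩ : ∃ N, 0 < N ∧ M ≤ N ∧ (n : ℝ) ^ 2 * N ≤ (n : ℝ) ^ 2 * M + ε := by
    refine ⟨M + ε / ((n : ℝ) ^ 2 + 1), by positivity, le_add_of_nonneg_right (by positivity), ?_⟩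
    rw [mul_add, add_le_add_iff_left, mul_div_assoc', div_le_iff₀ (by positivity)]
    nlinarith
  refine (abs_le'.mpr ⟨?_, ?_⟩).trans hNε
  · exact key Q hQ N hN0 fun x hx => (hM x hx).trans hNM
  · simpa using key (-Q) (by simpa using hQ) N hN0 fun x hx => by simpa using (hM x hx).trans hNM

lemma endpointBound_eigenvalue {lam : ℝ} (hlam : 0 < lam) (n : ℕ) :
    EndpointBound lam (n + 1) (fun k => (k : ℝ) * (k + 2 * lam)) ((2 * lam + 1) * (n : ℝ) ^ 2) := by
  intro b M hb
  have hdeg : (gegenSum lam (n + 1) b).degree ≤ n := by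
    refine degree_le_of_natDegree_le (natDegree_sum_le_of_forall_le _ _ fun k hk => ?_)
    exact (natDegree_C_mul_le _ _).trans
      ((natDegree_gegenPoly_le lam k).trans (Nat.lt_succ_iff.mp (Finset.mem_range.mp hk)))
  have h1 := abs_derivative_eval_one_le hdeg fun x hx => by
    rw [eval_gegenSum]; exact hb x hx
  have h2 := eval_gegenOp_gegenSum lam (n + 1) b 1
  rw [gegenOp_apply] at h2
  simp only [eval_sub, eval_mul, eval_one, eval_pow, eval_X, eval_C, one_pow, sub_self, zero_mul,
    zero_sub, mul_one, neg_inj] at h2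
  rw [← h2, abs_mul, abs_of_pos (by positivity), mul_assoc]
  gcongr

lemma endpointBound_resolvent {lam : ℝ} (hlam : 0 < lam) (n : ℕ) {s : ℝ} (hs : 0 < s) :
    EndpointBound lam n (fun k => s / (s + (k : ℝ) * (k + 2 * lam))) 1 := by
  intro b M hb
  have key (d : ℕ → ℝ)
      (hd : ∀ x ∈ Set.Icc (-1 : ℝ) 1, ∑ k ∈ Finset.range n, d k * (gegenPoly lam k).eval x ≤ M) :
      ∑ k ∈ Finset.range n, d k * (s / (s + (k : ℝ) * (k + 2 * lam))) *
        (gegenPoly lam k).eval 1 ≤ M := by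
    rw [← eval_gegenSum lam n fun k => d k * (s / (s + (k : ℝ) * (k + 2 * lam)))]
    refine eval_le_of_smul_sub_gegenOp_le hlam hs (fun x hx => ?_) (by norm_num)
    rw [eval_gegenOp_gegenSum, eval_gegenSum, sub_neg_eq_add, Finset.mul_sum,
      ← Finset.sum_add_distrib]
    refine le_of_eq_of_le ?_ (mul_le_mul_of_nonneg_left (hd x hx) hs.le)
    rw [Finset.mul_sum]
    refine Finset.sum_congr rfl fun k _ => ?_
    have : s + (k : ℝ) * (k + 2 * lam) ≠ 0 := by positivity
    field_simp
  rw [one_mul, abs_le']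
  refine ⟨key b fun x hx => (le_abs_self _).trans (hb x hx), ?_⟩
  have h := key (-b) fun x hx => by
    simpa [← Finset.sum_neg_distrib] using (neg_le_abs _).trans (hb x hx)
  simpa [← Finset.sum_neg_distrib] using h

lemma integral_Ioi_div_sq_add {a : ℝ} (ha : 0 ≤ a) :
    IntegrableOn (fun u : ℝ => a / (u ^ 2 + a)) (Set.Ioi 0) ∧
      ∫ u in Set.Ioi (0 : ℝ), a / (u ^ 2 + a) = √a * (π / 2) := by
  rcases ha.eq_or_lt with rfl | ha
  · simp
  have hs : 0 < √a := Real.sqrt_pos.mpr ha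
  have heq : (fun u : ℝ => a / (u ^ 2 + a)) = fun u => (1 + ((√a)⁻¹ * u) ^ 2)⁻¹ := by
    ext u
    rw [mul_pow, inv_pow, Real.sq_sqrt ha.le]
    field_simp
    ring
  rw [heq]
  constructor
  · exact (integrable_inv_one_add_sq.comp_mul_left' (inv_ne_zero hs.ne')).integrableOn
  · rw [integral_comp_mul_left_Ioi (fun u : ℝ => (1 + u ^ 2)⁻¹) 0 (inv_pos.mpr hs)]
    simp

lemma endpointBound_sqrt_eigenvalue {lam : ℝ} (hlam : 0 < lam) (n : ℕ) :
    EndpointBound lam (n + 1) (fun k => √((k : ℝ) * (k + 2 * lam)))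
      (3 * √(2 * lam + 1) * n) := by
  intro b M hb
  set μ : ℕ → ℝ := fun k => (k : ℝ) * (k + 2 * lam)
  have hμ (k : ℕ) : 0 ≤ μ k := by positivity
  set K : ℝ := (2 * lam + 1) * (n : ℝ) ^ 2 with hK
  have hK0 : 0 ≤ K := by positivity
  have hM0 : 0 ≤ M := (abs_nonneg _).trans (hb 0 (by norm_num))
  have hsum (u : ℝ) (hu : 0 < u) :
      |∑ k ∈ Finset.range (n + 1), b k * (μ k / (u ^ 2 + μ k)) * (gegenPoly lam k).eval 1| ≤
        3 * M * (K / (u ^ 2 + K)) := by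
    have hres := endpointBound_resolvent hlam (n + 1) (s := u ^ 2) (by positivity)
    have h1 := hres b M hb
    have h2 := (hres.mul hlam (endpointBound_eigenvalue hlam n)) b M hb
    have h3 := hb 1 (by norm_num)
    have e1 : ∑ k ∈ Finset.range (n + 1), b k * (μ k / (u ^ 2 + μ k)) * (gegenPoly lam k).eval 1 =
        ∑ k ∈ Finset.range (n + 1), b k * (gegenPoly lam k).eval 1 -
          ∑ k ∈ Finset.range (n + 1), b k * (u ^ 2 / (u ^ 2 + μ k)) *
            (gegenPoly lam k).eval 1 := by
      rw [← Finset.sum_sub_distrib]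
      refine Finset.sum_congr rfl fun k _ => ?_
      have : u ^ 2 + μ k ≠ 0 := by have := hμ k; positivity
      field_simp
      ring
    have e2 : ∑ k ∈ Finset.range (n + 1), b k * (u ^ 2 / (u ^ 2 + μ k) * μ k) *
          (gegenPoly lam k).eval 1 =
        u ^ 2 * ∑ k ∈ Finset.range (n + 1), b k * (μ k / (u ^ 2 + μ k)) *
          (gegenPoly lam k).eval 1 := by
      rw [Finset.mul_sum]
      exact Finset.sum_congr rfl fun k _ => by ring
    rw [e2, abs_mul, abs_of_pos (by positivity)] at h2
    have h4 : |∑ k ∈ Finset.range (n + 1), b k * (μ k / (u ^ 2 + μ k)) *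
        (gegenPoly lam k).eval 1| ≤ 2 * M := by
      rw [e1]
      exact (abs_sub _ _).trans (by linarith)
    rw [mul_div_assoc', le_div_iff₀ (by positivity)]
    nlinarith [mul_le_mul_of_nonneg_left h4 hK0]
  have h_int (k : ℕ) : IntegrableOn (fun u : ℝ => b k * (μ k / (u ^ 2 + μ k)) *
      (gegenPoly lam k).eval 1) (Set.Ioi 0) :=
    ((integral_Ioi_div_sq_add (hμ k)).1.const_mul _).mul_const _
  have heq : ∫ u in Set.Ioi (0 : ℝ), ∑ k ∈ Finset.range (n + 1),
      b k * (μ k / (u ^ 2 + μ k)) * (gegenPoly lam k).eval 1 =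
      (∑ k ∈ Finset.range (n + 1), b k * √(μ k) * (gegenPoly lam k).eval 1) * (π / 2) := by
    rw [integral_finsetSum _ fun k _ => h_int k, Finset.sum_mul]
    refine Finset.sum_congr rfl fun k _ => ?_
    rw [integral_mul_const, integral_const_mul, (integral_Ioi_div_sq_add (hμ k)).2]
    ring
  have hle := norm_integral_le_of_norm_le (f := fun u : ℝ => ∑ k ∈ Finset.range (n + 1),
      b k * (μ k / (u ^ 2 + μ k)) * (gegenPoly lam k).eval 1)
    ((integral_Ioi_div_sq_add hK0).1.const_mul (3 * M))
    ((ae_restrict_mem measurableSet_Ioi).mono hsum)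
  rw [heq, integral_const_mul, (integral_Ioi_div_sq_add hK0).2, Real.norm_eq_abs, abs_mul,
    abs_of_pos (by positivity : 0 < π / 2), ← mul_assoc] at hle
  have hle' := le_of_mul_le_mul_right hle (by positivity)
  refine hle'.trans_eq ?_
  rw [hK, Real.sqrt_mul (by positivity), Real.sqrt_sq (by positivity)]
  ring

/-- Multipliers that are bounded at the endpoint for the uniform norm are bounded on `L^p`. -/
lemma EndpointBound.eLpNorm_le {lam : ℝ} (hlam : 0 < lam) {n : ℕ} {a : ℕ → ℝ} {K : ℝ≥0}
    (ha : EndpointBound lam n a K) (b : ℕ → ℝ) {p : ℝ≥0∞} (hp : 1 ≤ p) :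
    eLpNorm (fun x => ∑ k ∈ Finset.range n, b k * a k * (gegenPoly lam k).eval x) p (νm lam) ≤
      K * eLpNorm (fun x => ∑ k ∈ Finset.range n, b k * (gegenPoly lam k).eval x) p (νm lam) := by
  have := isProbabilityMeasure_νm (κ := lam) (by linarith)
  have : Fact (1 ≤ p) := ⟨hp⟩
  have hmem (k : ℕ) : MemLp (fun x => (gegenPoly lam k).eval x) p (νm lam) := by
    obtain ⟨N, hN⟩ := (isCompact_Icc (a := (-1 : ℝ)) (b := 1)).exists_bound_of_continuousOn
      (gegenPoly lam k).continuous.continuousOn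
    exact MemLp.of_bound (gegenPoly lam k).continuous.aestronglyMeasurable N
      ((ae_νm_mem_Ioo lam).mono fun x hx => hN x (Set.Ioo_subset_Icc_self hx))
  set v : ℕ → Lp ℝ p (νm lam) := fun k => (hmem k).toLp _ with hv
  have hnorm (d : ℕ → ℝ) : ‖∑ k ∈ Finset.range n, d k • v k‖ₑ =
      eLpNorm (fun x => ∑ k ∈ Finset.range n, d k * (gegenPoly lam k).eval x) p (νm lam) := by
    have hsum : MemLp (fun x => ∑ k ∈ Finset.range n, d k * (gegenPoly lam k).eval x) p (νm lam) :=
      memLp_finsetSum _ fun k _ => (hmem k).const_mul (d k)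
    have : ∑ k ∈ Finset.range n, d k • v k = hsum.toLp _ := by
      refine Lp.ext (.trans ?_ hsum.coeFn_toLp.symm)
      refine (Lp.coeFn_finsetSum _ _).trans ?_
      have h1 : ∀ᵐ x ∂νm lam, ∀ k, (d k • v k : Lp ℝ p (νm lam)) x =
          d k * (gegenPoly lam k).eval x := by
        rw [ae_all_iff]
        intro k
        filter_upwards [Lp.coeFn_smul (d k) (v k), (hmem k).coeFn_toLp] with x hx hx'
        rw [hx, Pi.smul_apply, hx', smul_eq_mul]
      filter_upwards [h1] with x hx
      simp [hx]
    rw [this, Lp.enorm_toLp]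
  obtain ⟨φ, hφ1, hφ⟩ := exists_dual_vector'' ℝ (∑ k ∈ Finset.range n, (b k * a k) • v k)
  have hbound : ∀ y ∈ Set.Icc (-1 : ℝ) 1,
      |∑ k ∈ Finset.range n, b k * φ (v k) / (gegenPoly lam k).eval 1 * (gegenPoly lam k).eval y| ≤
        ‖∑ k ∈ Finset.range n, b k • v k‖ := by
    intro y hy
    have h1 : ‖∑ k ∈ Finset.range n,
        (b k * ((gegenPoly lam k).eval y / (gegenPoly lam k).eval 1)) • v k‖ₑ ≤
        ‖∑ k ∈ Finset.range n, b k • v k‖ₑ := by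
      rw [hnorm, hnorm]
      exact eLpNorm_translate_le hlam n b hy hp
    have h2 := φ.le_of_opNorm_le hφ1 (∑ k ∈ Finset.range n,
      (b k * ((gegenPoly lam k).eval y / (gegenPoly lam k).eval 1)) • v k)
    rw [one_mul] at h2
    refine le_of_eq_of_le ?_ (h2.trans (enorm_le_iff_norm_le.mp h1))
    rw [map_sum, Real.norm_eq_abs]
    congr 1
    refine Finset.sum_congr rfl fun k _ => ?_
    rw [map_smul, smul_eq_mul]
    ring
  have hmain := ha _ _ hbound
  have heq : ∑ k ∈ Finset.range n, b k * φ (v k) / (gegenPoly lam k).eval 1 * a k *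
      (gegenPoly lam k).eval 1 = ‖∑ k ∈ Finset.range n, (b k * a k) • v k‖ := by
    refine Eq.trans ?_ hφ
    rw [map_sum]
    refine Finset.sum_congr rfl fun k _ => ?_
    have := (eval_one_gegenPoly_pos hlam k).ne'
    rw [map_smul, smul_eq_mul]
    field_simp
  rw [heq, abs_norm] at hmain
  rw [← hnorm, ← hnorm, ← enorm_norm (∑ k ∈ Finset.range n, (b k * a k) • v k),
    ← enorm_norm (∑ k ∈ Finset.range n, b k • v k), Real.enorm_of_nonneg (norm_nonneg _),
    Real.enorm_of_nonneg (norm_nonneg _), ← ENNReal.ofReal_coe_nnreal,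
    ← ENNReal.ofReal_mul K.coe_nonneg]
  exact ENNReal.ofReal_le_ofReal hmain

end

/-- **Bernstein-type inequality for the Gegenbauer differential operator**
(Remark 4.1): let `λ > 0` and `r` a positive integer. For each `1 ≤ p ≤ ∞` there is a
constant `c`, depending only on `λ`, `p` and `r`, such that for every `n ≥ 1` and every
polynomial `g = Σ_{k=0}^n b_k C_k^λ` of degree at most `n`,
`‖(-Λ_λ)^{r/2} g‖_{w_λ,p} ≤ c n^r ‖g‖_{w_λ,p}`, where
`(-Λ_λ)^{r/2} g = Σ_{k=1}^n b_k (k(k+2λ))^{r/2} C_k^λ`. -/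
theorem bernstein_inequality_gegenbauer
    (lam : ℝ) (hlam : 0 < lam) (r : ℕ) (hr : 1 ≤ r) (p : ℝ≥0∞) (hp : 1 ≤ p) :
    ∃ c : ℝ≥0, ∀ n : ℕ, 1 ≤ n → ∀ b : ℕ → ℝ,
      eLpNorm
        (fun t => ∑ k ∈ Finset.Icc 1 n,
          b k * ((k : ℝ) * ((k : ℝ) + 2 * lam)) ^ ((r : ℝ) / 2) * gegen lam k t)
        p (νm lam)
      ≤ c * (n : ℝ≥0∞) ^ r *
        eLpNorm (fun t => ∑ k ∈ Finset.range (n + 1), b k * gegen lam k t) p (νm lam) := by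
  set c : ℝ≥0 := (3 * √(2 * lam + 1)).toNNReal with hc
  refine ⟨c ^ r, fun n _ b => ?_⟩
  have hK : (3 * √(2 * lam + 1) * n) ^ r = ((c ^ r * (n : ℝ≥0) ^ r : ℝ≥0) : ℝ) := by
    push_cast
    rw [hc, Real.coe_toNNReal _ (by positivity), mul_pow]
  have hbound := (endpointBound_sqrt_eigenvalue hlam n).pow hlam r
  rw [hK] at hbound
  have h := hbound.eLpNorm_le hlam b hp
  simp only [eval_gegenPoly] at h
  push_cast at h
  refine le_of_eq_of_le ?_ h
  congr 1
  ext t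
  rw [Finset.range_eq_Ico, Finset.sum_eq_sum_Ico_succ_bot (Nat.succ_pos n)]
  have h0 : √(((0 : ℕ) : ℝ) * (((0 : ℕ) : ℝ) + 2 * lam)) ^ r = 0 := by
    simp [Nat.one_le_iff_ne_zero.mp hr]
  rw [h0, mul_zero, zero_mul, zero_add]
  refine Finset.sum_congr rfl fun k _ => ?_
  rw [Real.sqrt_eq_rpow, ← Real.rpow_mul_natCast (by positivity), one_div_mul_eq_div]

end GegenbauerBernstein
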